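/- Let c > 0 and let k : (0,∞) → [0,∞) be a measurable function with ∫₀^∞ k(u) du = 1 and lim_{u→∞} u² k(u) = c. Fix p ∈ (0,1]. Then, as t → ∞, ∫₀^{t} (log^p(t−u+1)/(t−u+1)) k(u) du = log^p(t+1)/(t+1) + c·((2+p)/(1+p))·(log^{1+p} t)/t² · (1+o(1)); equivalently, lim_{t→∞} ( ∫₀^{t} (log^p(t−u+1)/(t−u+1)) k(u) du − log^p(t+1)/(t+1) ) · t²/log^{1+p} t = c(2+p)/(1+p). -/

import Mathlib

open MeasureTheory Filter

/-- A function dominated, for every `ε > 0`, by one with limit `C * ε` tends to zero. -/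
lemma tendsto_zero_of_abs_le_of_tendsto {α : Type*} {l : Filter α} {F : α → ℝ} (C : ℝ)
    (h : ∀ ε > 0, ∃ f : α → ℝ, Tendsto f l (nhds (C * ε)) ∧ ∀ᶠ t in l, |F t| ≤ f t) :
    Tendsto F l (nhds 0) := by
  rw [Metric.tendsto_nhds]
  intro δ hδ
  obtain ⟨f, hf, hle⟩ := h (δ / (|C| + 1)) (by positivity)
  have hlt : C * (δ / (|C| + 1)) < δ := by
    have h1 : 0 < |C| + 1 := by positivity
    rw [mul_div_assoc', div_lt_iff₀ h1]
    nlinarith [le_abs_self C]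
  filter_upwards [hle, hf.eventually (gt_mem_nhds hlt)] with t h1 h2
  rw [Real.dist_eq, sub_zero]
  exact h1.trans_lt h2

lemma tendsto_log_affine_div_log {a : ℝ} (ha : 0 < a) (b : ℝ) :
    Tendsto (fun t : ℝ => Real.log (a * t + b) / Real.log t) atTop (nhds 1) := by
  have h1 : Tendsto (fun t : ℝ => a + b / t) atTop (nhds (a + 0)) :=
    tendsto_const_nhds.add (tendsto_const_nhds.div_atTop tendsto_id)
  rw [add_zero] at h1
  have h2 := (h1.log ha.ne').div_atTop Real.tendsto_log_atTop
  have h3 := h2.const_add 1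
  rw [add_zero] at h3
  refine h3.congr' ?_
  filter_upwards [eventually_gt_atTop 1, h1.eventually (lt_mem_nhds ha)] with t ht hpos
  have hl : Real.log t ≠ 0 := (Real.log_pos ht).ne'
  have ht0 : t ≠ 0 := by positivity
  have : a * t + b = t * (a + b / t) := by field_simp
  rw [this, Real.log_mul ht0 hpos.ne']
  field_simp

lemma setIntegral_Ioc_inv {a b : ℝ} (ha : 0 < a) (hab : a ≤ b) :
    ∫ u in Set.Ioc a b, u⁻¹ = Real.log b - Real.log a := by
  rw [← intervalIntegral.integral_of_le hab, integral_inv_of_pos ha (ha.trans_le hab),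
    Real.log_div (ha.trans_le hab).ne' ha.ne']

lemma integrableOn_inv_Ioc {a b : ℝ} (ha : 0 < a) :
    IntegrableOn (fun u : ℝ => u⁻¹) (Set.Ioc a b) := by
  refine (ContinuousOn.integrableOn_Icc ?_).mono_set Set.Ioc_subset_Icc_self
  exact continuousOn_inv₀.mono fun u hu => (ha.trans_le hu.1).ne'

/-- If `h u ~ c / u` then the integral of `h` up to `T` is asymptotic to `c * log T`. -/
lemma tendsto_setIntegral_div_log {h : ℝ → ℝ} {c : ℝ}
    (hloc : ∀ T, IntegrableOn h (Set.Ioc 0 T))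
    (hlim : Tendsto (fun u => u * h u) atTop (nhds c)) :
    Tendsto (fun T => (∫ u in Set.Ioc 0 T, h u) / Real.log T) atTop (nhds c) := by
  rw [← tendsto_sub_nhds_zero_iff]
  refine tendsto_zero_of_abs_le_of_tendsto 1 fun ε hε => ?_
  obtain ⟨M₀, hM₀⟩ := eventually_atTop.1 (hlim.eventually (Metric.closedBall_mem_nhds c hε))
  obtain ⟨M, hM1, hM⟩ : ∃ M : ℝ, 1 ≤ M ∧ ∀ u ≥ M, |u * h u - c| ≤ ε :=
    ⟨max 1 M₀, le_max_left _ _, fun u hu => hM₀ u ((le_max_right _ _).trans hu)⟩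
  have hM0 : 0 < M := by linarith
  refine ⟨fun T => |(∫ u in Set.Ioc 0 M, h u) - c * Real.log M| / Real.log T + 1 * ε, ?_, ?_⟩
  · simpa using (tendsto_const_nhds.div_atTop Real.tendsto_log_atTop).add_const (1 * ε)
  filter_upwards [eventually_ge_atTop M, eventually_gt_atTop 1] with T hMT hT
  have hlog := Real.log_pos hT
  have hsplit : ∫ u in Set.Ioc 0 T, h u
      = (∫ u in Set.Ioc 0 M, h u) + ∫ u in Set.Ioc M T, h u := by
    rw [← setIntegral_union (Set.Ioc_disjoint_Ioc_of_le le_rfl) measurableSet_Ioc (hloc M)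
      ((hloc T).mono_set (Set.Ioc_subset_Ioc_left hM0.le)), Set.Ioc_union_Ioc_eq_Ioc hM0.le hMT]
  have hI : IntegrableOn h (Set.Ioc M T) := (hloc T).mono_set (Set.Ioc_subset_Ioc_left hM0.le)
  have hinv := integrableOn_inv_Ioc (b := T) hM0
  have hdiff : |∫ u in Set.Ioc M T, (h u - c * u⁻¹)| ≤ ε * Real.log T := by
    calc |∫ u in Set.Ioc M T, (h u - c * u⁻¹)|
        ≤ ∫ u in Set.Ioc M T, ε * u⁻¹ := by
          rw [← Real.norm_eq_abs]
          refine norm_integral_le_of_norm_le (hinv.const_mul ε) ?_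
          refine (ae_restrict_iff' measurableSet_Ioc).2 (ae_of_all _ fun u hu => ?_)
          have hu0 : 0 < u := hM0.trans hu.1
          have : h u - c * u⁻¹ = (u * h u - c) * u⁻¹ := by field_simp
          rw [this, Real.norm_eq_abs, abs_mul, abs_of_pos (inv_pos.2 hu0)]
          exact mul_le_mul_of_nonneg_right (hM u hu.1.le) (inv_pos.2 hu0).le
      _ = ε * (Real.log T - Real.log M) := by
          rw [integral_const_mul, setIntegral_Ioc_inv hM0 hMT]
      _ ≤ ε * Real.log T := by
          have := Real.log_nonneg hM1
          gcongr
          linarith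
  rw [integral_sub hI (hinv.const_mul c), integral_const_mul, setIntegral_Ioc_inv hM0 hMT] at hdiff
  have hmain : (∫ u in Set.Ioc 0 T, h u) / Real.log T - c
      = (((∫ u in Set.Ioc 0 M, h u) - c * Real.log M)
        + ((∫ u in Set.Ioc M T, h u) - c * (Real.log T - Real.log M))) / Real.log T := by
    rw [hsplit]
    field_simp
    ring
  rw [hmain, abs_div, abs_of_pos hlog, div_add' _ _ _ hlog.ne', one_mul]
  gcongr
  exact (abs_add_le _ _).trans (by gcongr)

/-- First order expansion of `x ↦ (log x) ^ p / x` with a quantitative remainder. -/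
lemma abs_log_rpow_div_sub_le {p x y : ℝ} (hp0 : 0 < p) (hp1 : p ≤ 1) (hy : 1 < y) (hyx : y ≤ x)
    (hxy : x ≤ 2 * y) :
    |Real.log y ^ p / y - Real.log x ^ p / x - Real.log x ^ p / x ^ 2 * (x - y)|
      ≤ Real.log x ^ p / x ^ 2 * (2 / x * (x - y) ^ 2 + 4 / Real.log x * (x - y)) := by
  have hy0 : 0 < y := by linarith
  have hx0 : 0 < x := by linarith
  have hly := Real.log_pos hy
  have hlyx : Real.log y ≤ Real.log x := Real.log_le_log hy0 hyx
  have hlx : 0 < Real.log x := by linarith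
  set a := Real.log x ^ p with ha
  have ha0 : 0 < a := Real.rpow_pos_of_pos hlx p
  have hmono : Real.log y ^ p ≤ a := Real.rpow_le_rpow hly.le hlyx hp0.le
  have hlower : a - Real.log y ^ p ≤ a * ((x - y) / y) / Real.log x := by
    have hr : Real.log y / Real.log x ≤ (Real.log y / Real.log x) ^ p :=
      Real.self_le_rpow_of_le_one (by positivity) ((div_le_one hlx).2 hlyx) hp1
    rw [Real.div_rpow hly.le hlx.le, ← ha, le_div_iff₀ ha0] at hr
    have hlog : Real.log x - Real.log y ≤ (x - y) / y := by
      rw [← Real.log_div hx0.ne' hy0.ne', sub_div, div_self hy0.ne']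
      exact Real.log_le_sub_one_of_pos (by positivity)
    calc a - Real.log y ^ p ≤ a - Real.log y / Real.log x * a := by linarith
      _ = a * (Real.log x - Real.log y) / Real.log x := by field_simp
      _ ≤ _ := by gcongr
  have heq : Real.log y ^ p / y - a / x - a / x ^ 2 * (x - y)
      = a / x ^ 2 * ((x - y) ^ 2 / y) - (a - Real.log y ^ p) / y := by
    field_simp
    ring
  have h1 : a / x ^ 2 * ((x - y) ^ 2 / y) ≤ a / x ^ 2 * (2 / x * (x - y) ^ 2) := by
    have : 1 / y ≤ 2 / x := by rw [div_le_div_iff₀ hy0 hx0]; linarith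
    gcongr
    calc (x - y) ^ 2 / y = 1 / y * (x - y) ^ 2 := by ring
      _ ≤ _ := by gcongr
  have h2 : (a - Real.log y ^ p) / y ≤ a / x ^ 2 * (4 / Real.log x * (x - y)) := by
    have hsq : 1 / y ^ 2 ≤ 4 / x ^ 2 := by
      rw [div_le_div_iff₀ (by positivity) (by positivity)]
      nlinarith
    have hd : 0 ≤ x - y := by linarith
    calc (a - Real.log y ^ p) / y ≤ a * ((x - y) / y) / Real.log x / y := by gcongr
      _ = a * (x - y) / Real.log x * (1 / y ^ 2) := by field_simp
      _ ≤ a * (x - y) / Real.log x * (4 / x ^ 2) := by gcongr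
      _ = _ := by ring
  have h3 : 0 ≤ a / x ^ 2 * ((x - y) ^ 2 / y) := by positivity
  have h4 : 0 ≤ (a - Real.log y ^ p) / y := div_nonneg (by linarith) hy0.le
  rw [heq, abs_le, mul_add]
  constructor <;> linarith

lemma continuousOn_log_rpow_div {p : ℝ} (hp0 : 0 < p) (t : ℝ) :
    ContinuousOn (fun u : ℝ => Real.log (t - u + 1) ^ p / (t - u + 1)) (Set.Iic t) := by
  have hne : ∀ u ∈ Set.Iic t, t - u + 1 ≠ 0 := fun u hu => by
    have : u ≤ t := hu
    linarith
  have hc : ContinuousOn (fun u : ℝ => t - u + 1) (Set.Iic t) := by fun_prop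
  exact ((hc.log hne).rpow_const fun u _ => Or.inr hp0.le).div hc hne

lemma setIntegral_log_rpow_div {p t : ℝ} (hp0 : 0 < p) (ht : 0 ≤ t) :
    ∫ u in Set.Ioc (t / 2) t, Real.log (t - u + 1) ^ p / (t - u + 1)
      = Real.log (t / 2 + 1) ^ (1 + p) / (1 + p) := by
  have hle : t / 2 ≤ t := by linarith
  rw [← intervalIntegral.integral_of_le hle]
  have hderiv : ∀ u ∈ Set.uIcc (t / 2) t,
      HasDerivAt (fun u => -(Real.log (t - u + 1) ^ (1 + p) / (1 + p)))
        (Real.log (t - u + 1) ^ p / (t - u + 1)) u := by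
    intro u hu
    rw [Set.uIcc_of_le hle] at hu
    have hpos : t - u + 1 ≠ 0 := by linarith [hu.2]
    have h1 : HasDerivAt (fun u : ℝ => t - u + 1) (-1) u :=
      ((hasDerivAt_id u).const_sub t).add_const 1
    have h2 := (((h1.log hpos).rpow_const (p := 1 + p) (Or.inr (by linarith))).div_const
      (1 + p)).neg
    refine h2.congr_deriv ?_
    rw [add_sub_cancel_left]
    field_simp
  rw [intervalIntegral.integral_eq_sub_of_hasDerivAt hderiv]
  · have : t - t / 2 + 1 = t / 2 + 1 := by ring
    rw [this, sub_self, zero_add, Real.log_one, Real.zero_rpow (by linarith)]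
    simp
  · refine ContinuousOn.intervalIntegrable ((continuousOn_log_rpow_div hp0 t).mono ?_)
    rw [Set.uIcc_of_le hle]
    exact fun u hu => hu.2

/-- The contribution of the upper half of the interval of integration. -/
lemma tendsto_setIntegral_upper_half {k : ℝ → ℝ} {c p : ℝ} (hc : 0 < c) (hp0 : 0 < p)
    (hk : IntegrableOn k (Set.Ioi 0))
    (hk_tail : Tendsto (fun u : ℝ => u ^ 2 * k u) atTop (nhds c)) :
    Tendsto (fun t : ℝ =>
      (∫ u in Set.Ioc (t / 2) t, Real.log (t - u + 1) ^ p / (t - u + 1) * k u) * t ^ 2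
        / Real.log t ^ (1 + p)) atTop (nhds (c / (1 + p))) := by
  have hG : Tendsto (fun t : ℝ => Real.log (t / 2 + 1) ^ (1 + p) / (1 + p) / Real.log t ^ (1 + p))
      atTop (nhds (1 / (1 + p))) := by
    have h1 := ((tendsto_log_affine_div_log (a := 1 / 2) (by norm_num) 1).rpow_const
      (p := 1 + p) (Or.inr (by linarith))).div_const (1 + p)
    rw [Real.one_rpow] at h1
    refine h1.congr' ?_
    filter_upwards [eventually_gt_atTop 1] with t ht
    have e : 1 / 2 * t + 1 = t / 2 + 1 := by ring
    rw [e, Real.div_rpow (Real.log_nonneg (by linarith)) (Real.log_pos ht).le, div_right_comm]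
  have hL : Tendsto (fun t : ℝ => Real.log (t + 1) ^ p / Real.log t ^ (1 + p)) atTop (nhds 0) := by
    have h1 := ((tendsto_log_affine_div_log one_pos 1).rpow_const
      (p := p) (Or.inr hp0.le)).div_atTop Real.tendsto_log_atTop
    refine h1.congr' ?_
    filter_upwards [eventually_gt_atTop 1] with t ht
    have hl := Real.log_pos ht
    rw [one_mul, Real.div_rpow (Real.log_nonneg (by linarith)) hl.le, Real.rpow_add hl,
      Real.rpow_one, div_div, mul_comm (Real.log t)]
  have key : Tendsto (fun t : ℝ =>
      (∫ u in Set.Ioc (t / 2) t, Real.log (t - u + 1) ^ p / (t - u + 1) * k u) * t ^ 2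
        / Real.log t ^ (1 + p)
      - c * (Real.log (t / 2 + 1) ^ (1 + p) / (1 + p) / Real.log t ^ (1 + p)))
      atTop (nhds 0) := by
    refine tendsto_zero_of_abs_le_of_tendsto (4 / (1 + p)) fun ε hε => ?_
    refine ⟨fun t => 4 * ε * (Real.log (t / 2 + 1) ^ (1 + p) / (1 + p) / Real.log t ^ (1 + p))
      + 4 * c * (Real.log (t + 1) ^ p / Real.log t ^ (1 + p)), ?_, ?_⟩
    · convert (hG.const_mul (4 * ε)).add (hL.const_mul (4 * c)) using 2
      ring
    obtain ⟨M, hM⟩ := eventually_atTop.1 (hk_tail.eventually (Metric.closedBall_mem_nhds c hε))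
    filter_upwards [eventually_gt_atTop 1, eventually_ge_atTop (2 * M)] with t ht1 htM
    have ht0 : 0 < t := by linarith
    have hl : 0 < Real.log t ^ (1 + p) := Real.rpow_pos_of_pos (Real.log_pos ht1) _
    set g : ℝ → ℝ := fun u => Real.log (t - u + 1) ^ p / (t - u + 1) with hg
    have hgcont : ContinuousOn g (Set.Icc (t / 2) t) :=
      (continuousOn_log_rpow_div hp0 t).mono fun u hu => hu.2
    have hgint : IntegrableOn g (Set.Ioc (t / 2) t) :=
      hgcont.integrableOn_Icc.mono_set Set.Ioc_subset_Icc_self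
    have hkint : IntegrableOn k (Set.Icc (t / 2) t) :=
      hk.mono_set fun u hu => (by linarith [hu.1] : (0 : ℝ) < u)
    have hgk : IntegrableOn (fun u => g u * k u) (Set.Ioc (t / 2) t) :=
      (hkint.continuousOn_mul hgcont isCompact_Icc).mono_set Set.Ioc_subset_Icc_self
    have hconst : IntegrableOn (fun _ : ℝ => 4 * c / t ^ 3 * (2 * Real.log (t + 1) ^ p))
        (Set.Ioc (t / 2) t) := integrableOn_const (by simp)
    have hbound : |∫ u in Set.Ioc (t / 2) t, (g u * k u - c / t ^ 2 * g u)|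
        ≤ ∫ u in Set.Ioc (t / 2) t,
          (4 * ε / t ^ 2 * g u + 4 * c / t ^ 3 * (2 * Real.log (t + 1) ^ p)) := by
      rw [← Real.norm_eq_abs]
      refine norm_integral_le_of_norm_le ((hgint.const_mul _).add hconst) ?_
      refine (ae_restrict_iff' measurableSet_Ioc).2 (ae_of_all _ fun u hu => ?_)
      have hu0 : 0 < u := by linarith [hu.1]
      have hd : 0 ≤ t - u := by linarith [hu.2]
      have hlog0 : 0 ≤ Real.log (t - u + 1) := Real.log_nonneg (by linarith)
      have hg0 : 0 ≤ g u := by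
        have := Real.rpow_nonneg hlog0 p
        simp only [hg]
        positivity
      have hgd : g u * (t - u) ≤ Real.log (t + 1) ^ p := by
        have h1 : Real.log (t - u + 1) ^ p ≤ Real.log (t + 1) ^ p :=
          Real.rpow_le_rpow hlog0 (Real.log_le_log (by linarith) (by linarith)) hp0.le
        have h2 := Real.rpow_nonneg hlog0 p
        simp only [hg]
        rw [div_mul_eq_mul_div, div_le_iff₀ (by linarith)]
        nlinarith
      have hku : |u ^ 2 * k u - c| ≤ ε := hM u (by linarith [hu.1])
      have hsq : 1 / u ^ 2 ≤ 4 / t ^ 2 := by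
        rw [div_le_div_iff₀ (by positivity) (by positivity)]
        nlinarith [hu.1]
      have hdecomp : g u * k u - c / t ^ 2 * g u
          = g u * ((u ^ 2 * k u - c) * (1 / u ^ 2))
            + g u * (t - u) * (c * (t + u) / t ^ 2 * (1 / u ^ 2)) := by
        field_simp
        ring
      rw [hdecomp, Real.norm_eq_abs]
      refine (abs_add_le _ _).trans (add_le_add ?_ ?_)
      · rw [abs_mul, abs_of_nonneg hg0, abs_mul, abs_of_nonneg (by positivity : 0 ≤ 1 / u ^ 2)]
        calc g u * (|u ^ 2 * k u - c| * (1 / u ^ 2)) ≤ g u * (ε * (4 / t ^ 2)) := by gcongr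
          _ = _ := by ring
      · rw [abs_of_nonneg (by positivity)]
        have hL0 : 0 ≤ Real.log (t + 1) ^ p := Real.rpow_nonneg (Real.log_nonneg (by linarith)) p
        have htu : t + u ≤ 2 * t := by linarith [hu.2]
        calc g u * (t - u) * (c * (t + u) / t ^ 2 * (1 / u ^ 2))
            ≤ Real.log (t + 1) ^ p * (c * (2 * t) / t ^ 2 * (4 / t ^ 2)) := by gcongr
          _ = _ := by field_simp
    have hvol : volume.real (Set.Ioc (t / 2) t) = t / 2 := by
      rw [Real.volume_real_Ioc_of_le (by linarith)]
      ring
    rw [integral_sub hgk (hgint.const_mul _), integral_add (hgint.const_mul _) hconst,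
      integral_const_mul, integral_const_mul, setIntegral_const, hvol, smul_eq_mul, hg,
      setIntegral_log_rpow_div hp0 ht0.le] at hbound
    set J := ∫ u in Set.Ioc (t / 2) t, Real.log (t - u + 1) ^ p / (t - u + 1) * k u
    have e1 : J * t ^ 2 / Real.log t ^ (1 + p)
        - c * (Real.log (t / 2 + 1) ^ (1 + p) / (1 + p) / Real.log t ^ (1 + p))
        = (J - c / t ^ 2 * (Real.log (t / 2 + 1) ^ (1 + p) / (1 + p)))
          * (t ^ 2 / Real.log t ^ (1 + p)) := by
      field_simp
    rw [e1, abs_mul, abs_of_nonneg (by positivity : 0 ≤ t ^ 2 / Real.log t ^ (1 + p))]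
    refine (mul_le_mul_of_nonneg_right hbound (by positivity)).trans (le_of_eq ?_)
    field_simp
  have h := key.add (hG.const_mul c)
  simpa [div_eq_mul_inv] using h

lemma tendsto_div_add_one_atTop : Tendsto (fun t : ℝ => t / (t + 1)) atTop (nhds 1) := by
  have h := (tendsto_inv_atTop_zero.comp
    (tendsto_atTop_add_const_right atTop (1 : ℝ) tendsto_id)).const_sub 1
  rw [sub_zero] at h
  refine h.congr' ?_
  filter_upwards [eventually_gt_atTop 0] with t ht
  simp only [Function.comp, id]
  field_simp
  ring

/-- The contribution of the lower half of the interval of integration. -/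
lemma tendsto_setIntegral_lower_half {k : ℝ → ℝ} {c p : ℝ} (hp0 : 0 < p) (hp1 : p ≤ 1)
    (hk_nonneg : ∀ u > (0 : ℝ), 0 ≤ k u) (hk : IntegrableOn k (Set.Ioi 0))
    (hk_tail : Tendsto (fun u : ℝ => u ^ 2 * k u) atTop (nhds c)) :
    Tendsto (fun t : ℝ =>
      (∫ u in Set.Ioc 0 (t / 2), (Real.log (t - u + 1) ^ p / (t - u + 1)
        - Real.log (t + 1) ^ p / (t + 1)) * k u) * t ^ 2 / Real.log t ^ (1 + p))
      atTop (nhds c) := by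
  have hkT : ∀ T, IntegrableOn k (Set.Icc 0 T) := fun T =>
    (integrableOn_Icc_iff_integrableOn_Ioc).2 (hk.mono_set fun u hu => hu.1)
  have hmulk : ∀ (f : ℝ → ℝ) (T : ℝ), ContinuousOn f (Set.Icc 0 T) →
      IntegrableOn (fun u => f u * k u) (Set.Ioc 0 T) := fun f T hf =>
    ((hkT T).continuousOn_mul hf isCompact_Icc).mono_set Set.Ioc_subset_Icc_self
  set I : ℝ → ℝ := fun T => ∫ u in Set.Ioc 0 T, u * k u with hI
  have hI_lim : Tendsto (fun t => I (t / 2) / Real.log t) atTop (nhds c) := by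
    have h1 : Tendsto (fun T => I T / Real.log T) atTop (nhds c) :=
      tendsto_setIntegral_div_log (fun T => hmulk _ T continuousOn_id)
        (hk_tail.congr fun u => by ring)
    have h2 := (h1.comp (tendsto_id.atTop_div_const two_pos)).mul
      (tendsto_log_affine_div_log (a := 1 / 2) (by norm_num) 0)
    rw [mul_one] at h2
    refine h2.congr' ?_
    filter_upwards [eventually_gt_atTop 2] with t ht
    have e : 1 / 2 * t + 0 = t / 2 := by ring
    have hl : Real.log (t / 2) ≠ 0 := (Real.log_pos (by linarith)).ne'
    simp only [Function.comp, id, e]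
    field_simp
  obtain ⟨M₀, hM₀⟩ := eventually_atTop.1 (hk_tail.eventually (gt_mem_nhds (lt_add_one c)))
  obtain ⟨M, hM0, hM⟩ : ∃ M : ℝ, 0 ≤ M ∧ ∀ u ≥ M, u ^ 2 * k u ≤ c + 1 :=
    ⟨max 0 M₀, le_max_left _ _, fun u hu => (hM₀ u ((le_max_right _ _).trans hu)).le⟩
  have hc1 : 0 ≤ c + 1 :=
    (mul_nonneg (sq_nonneg _) (hk_nonneg (M + 1) (by linarith))).trans (hM (M + 1) (by linarith))
  set K := ∫ u in Set.Ioi 0, k u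
  have hsecond : ∀ T, 0 ≤ T →
      ∫ u in Set.Ioc 0 T, u ^ 2 * k u ≤ M ^ 2 * K + (c + 1) * T := by
    intro T hT
    have hkI : IntegrableOn k (Set.Ioc 0 T) := hk.mono_set fun u hu => hu.1
    have hconst : IntegrableOn (fun _ : ℝ => c + 1) (Set.Ioc 0 T) := integrableOn_const (by simp)
    calc ∫ u in Set.Ioc 0 T, u ^ 2 * k u
        ≤ ∫ u in Set.Ioc 0 T, (M ^ 2 * k u + (c + 1)) := by
          refine setIntegral_mono_on (hmulk _ T (by fun_prop)) ((hkI.const_mul _).add hconst)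
            measurableSet_Ioc fun u hu => ?_
          have hk0 := hk_nonneg u hu.1
          rcases le_total M u with h | h
          · have := hM u h
            nlinarith [mul_nonneg (sq_nonneg M) hk0]
          · have : u ^ 2 ≤ M ^ 2 := pow_le_pow_left₀ hu.1.le h 2
            nlinarith
      _ = M ^ 2 * (∫ u in Set.Ioc 0 T, k u) + (c + 1) * T := by
          rw [integral_add (hkI.const_mul _) hconst, integral_const_mul, setIntegral_const,
            Real.volume_real_Ioc_of_le hT, smul_eq_mul]
          ring
      _ ≤ _ := by
          gcongr
          refine setIntegral_mono_set hk ?_ (ae_of_all _ fun u hu => hu.1)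
          exact (ae_restrict_iff' measurableSet_Ioi).2 (ae_of_all _ hk_nonneg)
  have ha : Tendsto (fun t => (Real.log (t + 1) / Real.log t) ^ p) atTop (nhds 1) := by
    simpa using (tendsto_log_affine_div_log one_pos 1).rpow_const (p := p) (Or.inr hp0.le)
  have hx : Tendsto (fun t : ℝ => t + 1) atTop atTop :=
    tendsto_atTop_add_const_right _ 1 tendsto_id
  have hq := tendsto_div_add_one_atTop
  have hQ : Tendsto (fun t : ℝ => (t / (t + 1)) ^ 2 * (Real.log (t + 1) / Real.log t) ^ p)
      atTop (nhds 1) := by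
    simpa using (hq.pow 2).mul ha
  have hR : Tendsto (fun t : ℝ => (2 * (M ^ 2 * K) / (t + 1) + (c + 1) * (t / (t + 1)))
      / Real.log t + 4 * (I (t / 2) / Real.log t) / Real.log (t + 1)) atTop (nhds (0 + 0)) :=
    (((tendsto_const_nhds.div_atTop hx).add (hq.const_mul _)).div_atTop
      Real.tendsto_log_atTop).add
      ((hI_lim.const_mul 4).div_atTop (Real.tendsto_log_atTop.comp hx))
  have hbound := hQ.mul hR
  rw [add_zero, mul_zero] at hbound
  have hmain := hQ.mul hI_lim
  rw [one_mul] at hmain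
  rw [← tendsto_sub_nhds_zero_iff] at hmain ⊢
  have herr : Tendsto (fun t : ℝ =>
      (∫ u in Set.Ioc 0 (t / 2), (Real.log (t - u + 1) ^ p / (t - u + 1)
        - Real.log (t + 1) ^ p / (t + 1)) * k u) * t ^ 2 / Real.log t ^ (1 + p)
      - (t / (t + 1)) ^ 2 * (Real.log (t + 1) / Real.log t) ^ p * (I (t / 2) / Real.log t))
      atTop (nhds 0) := by
    refine squeeze_zero_norm' ?_ hbound
    filter_upwards [eventually_gt_atTop 1] with t ht
    have ht0 : 0 < t := by linarith
    have hl : 0 < Real.log t := Real.log_pos ht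
    have hlx : 0 < Real.log (t + 1) := Real.log_pos (by linarith)
    set a := Real.log (t + 1) ^ p with ha_def
    have ha0 : 0 < a := Real.rpow_pos_of_pos hlx p
    have hlp : 0 < Real.log t ^ p := Real.rpow_pos_of_pos hl p
    set g : ℝ → ℝ := fun u => Real.log (t - u + 1) ^ p / (t - u + 1) with hg
    have hgcont : ContinuousOn g (Set.Icc 0 (t / 2)) :=
      (continuousOn_log_rpow_div hp0 t).mono fun u hu => by
        have := hu.2
        simp only [Set.mem_Iic]
        linarith
    have hintE : IntegrableOn (fun u => (g u - a / (t + 1)) * k u) (Set.Ioc 0 (t / 2)) :=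
      hmulk _ _ (hgcont.sub continuousOn_const)
    have hintI : IntegrableOn (fun u => u * k u) (Set.Ioc 0 (t / 2)) := hmulk _ _ continuousOn_id
    have hintS : IntegrableOn (fun u => u ^ 2 * k u) (Set.Ioc 0 (t / 2)) := hmulk _ _ (by fun_prop)
    have hE : |∫ u in Set.Ioc 0 (t / 2),
          ((g u - a / (t + 1)) * k u - a / (t + 1) ^ 2 * (u * k u))|
        ≤ ∫ u in Set.Ioc 0 (t / 2), (a / (t + 1) ^ 2 * (2 / (t + 1)) * (u ^ 2 * k u)
          + a / (t + 1) ^ 2 * (4 / Real.log (t + 1)) * (u * k u)) := by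
      rw [← Real.norm_eq_abs]
      refine norm_integral_le_of_norm_le ((hintS.const_mul _).add (hintI.const_mul _)) ?_
      refine (ae_restrict_iff' measurableSet_Ioc).2 (ae_of_all _ fun u hu => ?_)
      have hk0 := hk_nonneg u hu.1
      have h := abs_log_rpow_div_sub_le (p := p) (x := t + 1) (y := t - u + 1) hp0 hp1
        (by linarith [hu.2]) (by linarith [hu.1]) (by linarith [hu.2])
      have e : t + 1 - (t - u + 1) = u := by ring
      rw [e] at h
      have e2 : (g u - a / (t + 1)) * k u - a / (t + 1) ^ 2 * (u * k u)
          = (g u - a / (t + 1) - a / (t + 1) ^ 2 * u) * k u := by ring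
      rw [e2, Real.norm_eq_abs, abs_mul, abs_of_nonneg hk0]
      refine (mul_le_mul_of_nonneg_right h hk0).trans (le_of_eq ?_)
      rw [← ha_def]
      ring
    rw [integral_sub hintE (hintI.const_mul _),
      integral_add (hintS.const_mul _) (hintI.const_mul _), integral_const_mul,
      integral_const_mul, integral_const_mul] at hE
    change |_ - _ * I (t / 2)| ≤ _ + _ * I (t / 2) at hE
    have hS := hsecond (t / 2) (by linarith)
    have hE' := hE.trans (add_le_add_left (mul_le_mul_of_nonneg_left hS
      (by positivity : 0 ≤ a / (t + 1) ^ 2 * (2 / (t + 1)))) _)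
    set X := ∫ u in Set.Ioc 0 (t / 2), (g u - a / (t + 1)) * k u
    have hrpow : Real.log t ^ (1 + p) = Real.log t * Real.log t ^ p := by
      rw [Real.rpow_add hl, Real.rpow_one]
    rw [Real.div_rpow hlx.le hl.le, ← ha_def, hrpow]
    have e3 : X * t ^ 2 / (Real.log t * Real.log t ^ p)
        - (t / (t + 1)) ^ 2 * (a / Real.log t ^ p) * (I (t / 2) / Real.log t)
        = (X - a / (t + 1) ^ 2 * I (t / 2)) * (t ^ 2 / (Real.log t * Real.log t ^ p)) := by
      field_simp
    rw [e3, Real.norm_eq_abs, abs_mul,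
      abs_of_pos (by positivity : 0 < t ^ 2 / (Real.log t * Real.log t ^ p))]
    refine (mul_le_mul_of_nonneg_right hE' (by positivity)).trans (le_of_eq ?_)
    field_simp
  have h := herr.add hmain
  rw [add_zero] at h
  exact h.congr fun t => by ring

lemma tendsto_tail_correction {k : ℝ → ℝ} {c p : ℝ} (hp0 : 0 < p)
    (hk_nonneg : ∀ u > (0 : ℝ), 0 ≤ k u) (hk : IntegrableOn k (Set.Ioi 0))
    (hk_tail : Tendsto (fun u : ℝ => u ^ 2 * k u) atTop (nhds c)) :
    Tendsto (fun t : ℝ => Real.log (t + 1) ^ p / (t + 1) * (∫ u in Set.Ioi (t / 2), k u) * t ^ 2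
      / Real.log t ^ (1 + p)) atTop (nhds 0) := by
  have ha : Tendsto (fun t => (Real.log (t + 1) / Real.log t) ^ p) atTop (nhds 1) := by
    simpa using (tendsto_log_affine_div_log one_pos 1).rpow_const (p := p) (Or.inr hp0.le)
  have hlim := ((ha.mul tendsto_div_add_one_atTop).mul_const (2 * (c + 1))).div_atTop
    Real.tendsto_log_atTop
  obtain ⟨M, hM⟩ := eventually_atTop.1 (hk_tail.eventually (gt_mem_nhds (lt_add_one c)))
  refine squeeze_zero' ?_ ?_ hlim
  · filter_upwards [eventually_gt_atTop 1] with t ht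
    have h1 : 0 ≤ ∫ u in Set.Ioi (t / 2), k u :=
      setIntegral_nonneg measurableSet_Ioi fun u hu =>
        hk_nonneg u ((by linarith : 0 < t / 2).trans hu)
    have h2 := Real.rpow_nonneg (Real.log_pos ht).le (1 + p)
    have h3 := Real.rpow_nonneg (Real.log_nonneg (by linarith : 1 ≤ t + 1)) p
    positivity
  filter_upwards [eventually_gt_atTop 1, eventually_ge_atTop (2 * M)] with t ht htM
  have ht0 : 0 < t / 2 := by linarith
  have hl : 0 < Real.log t := Real.log_pos ht
  have hlx : 0 ≤ Real.log (t + 1) := Real.log_nonneg (by linarith)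
  have htail : ∫ u in Set.Ioi (t / 2), k u ≤ 2 * (c + 1) / t := by
    calc ∫ u in Set.Ioi (t / 2), k u
        ≤ ∫ u in Set.Ioi (t / 2), (c + 1) * u ^ (-2 : ℝ) := by
          refine setIntegral_mono_on (hk.mono_set (Set.Ioi_subset_Ioi ht0.le))
            ((integrableOn_Ioi_rpow_of_lt (by norm_num) ht0).const_mul _)
            measurableSet_Ioi fun u hu => ?_
          have hu' : t / 2 < u := hu
          have hu0 : 0 < u := ht0.trans hu'
          rw [Real.rpow_neg hu0.le, Real.rpow_two, ← div_eq_mul_inv, le_div_iff₀ (by positivity),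
            mul_comm]
          exact (hM u (by linarith)).le
      _ = 2 * (c + 1) / t := by
          rw [integral_const_mul, integral_Ioi_rpow_of_lt (by norm_num) ht0]
          norm_num
          rw [Real.rpow_neg_one]
          field_simp
  have ha0 := Real.rpow_nonneg hlx p
  have hlp : 0 < Real.log t ^ p := Real.rpow_pos_of_pos hl p
  rw [Real.rpow_add hl, Real.rpow_one, Real.div_rpow hlx hl.le]
  calc _ ≤ Real.log (t + 1) ^ p / (t + 1) * (2 * (c + 1) / t) * t ^ 2
        / (Real.log t * Real.log t ^ p) := by gcongr
    _ = _ := by field_simp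

/-- full-interval asymptotics of ∫₀^{t} (log^p(t−u+1)/(t−u+1)) k(u) du. -/
theorem integral_log_kernel_full
    (c : ℝ) (hc : 0 < c) (k : ℝ → ℝ)
    (hk_meas : Measurable k)
    (hk_nonneg : ∀ u > (0:ℝ), 0 ≤ k u)
    (hk_int : ∫ u in Set.Ioi (0:ℝ), k u = 1)
    (hk_tail : Tendsto (fun u : ℝ => u ^ 2 * k u) atTop (nhds c))
    (p : ℝ) (hp : p ∈ Set.Ioc (0:ℝ) 1) :
    Tendsto (fun t : ℝ =>
        ((∫ u in Set.Ioc (0:ℝ) t,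
            (Real.log (t - u + 1)) ^ p / (t - u + 1) * k u)
          - (Real.log (t + 1)) ^ p / (t + 1)) * t ^ 2 / (Real.log t) ^ (1 + p))
      atTop (nhds (c * (2 + p) / (1 + p))) := by
  obtain ⟨hp0, hp1⟩ := hp
  have hk : IntegrableOn k (Set.Ioi 0) :=
    not_imp_comm.1 integral_undef (by rw [hk_int]; exact one_ne_zero)
  have h := ((tendsto_setIntegral_lower_half hp0 hp1 hk_nonneg hk hk_tail).add
    (tendsto_setIntegral_upper_half hc hp0 hk hk_tail)).sub
    (tendsto_tail_correction hp0 hk_nonneg hk hk_tail)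
  have hval : c + c / (1 + p) - 0 = c * (2 + p) / (1 + p) := by
    field_simp
    ring
  rw [hval] at h
  refine h.congr' ?_
  filter_upwards [eventually_gt_atTop 0] with t ht
  have hle : t / 2 ≤ t := by linarith
  have hgk : IntegrableOn (fun u => Real.log (t - u + 1) ^ p / (t - u + 1) * k u)
      (Set.Ioc 0 t) := by
    have hkt : IntegrableOn k (Set.Icc 0 t) :=
      (integrableOn_Icc_iff_integrableOn_Ioc).2 (hk.mono_set fun u hu => hu.1)
    exact (hkt.continuousOn_mul ((continuousOn_log_rpow_div hp0 t).mono fun u hu => hu.2)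
      isCompact_Icc).mono_set Set.Ioc_subset_Icc_self
  have hlow := hgk.mono_set (Set.Ioc_subset_Ioc_right hle)
  have hkl : IntegrableOn k (Set.Ioc 0 (t / 2)) := hk.mono_set fun u hu => hu.1
  have hone : 1 = (∫ u in Set.Ioc 0 (t / 2), k u) + ∫ u in Set.Ioi (t / 2), k u := by
    rw [← hk_int, ← setIntegral_union (Set.Ioc_disjoint_Ioi le_rfl) measurableSet_Ioi hkl
      (hk.mono_set (Set.Ioi_subset_Ioi (by linarith))), Set.Ioc_union_Ioi_eq_Ioi (by linarith)]
  have hsplit : ∫ u in Set.Ioc 0 t, Real.log (t - u + 1) ^ p / (t - u + 1) * k u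
      = (∫ u in Set.Ioc 0 (t / 2), Real.log (t - u + 1) ^ p / (t - u + 1) * k u)
        + ∫ u in Set.Ioc (t / 2) t, Real.log (t - u + 1) ^ p / (t - u + 1) * k u := by
    rw [← setIntegral_union (Set.Ioc_disjoint_Ioc_of_le le_rfl) measurableSet_Ioc hlow
      (hgk.mono_set (Set.Ioc_subset_Ioc_left (by linarith))),
      Set.Ioc_union_Ioc_eq_Ioc (by linarith) hle]
  have hdiff : ∫ u in Set.Ioc 0 (t / 2), (Real.log (t - u + 1) ^ p / (t - u + 1)
        - Real.log (t + 1) ^ p / (t + 1)) * k u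
      = (∫ u in Set.Ioc 0 (t / 2), Real.log (t - u + 1) ^ p / (t - u + 1) * k u)
        - Real.log (t + 1) ^ p / (t + 1) * ∫ u in Set.Ioc 0 (t / 2), k u := by
    simp_rw [sub_mul]
    rw [integral_sub hlow (hkl.const_mul _), integral_const_mul]
  rw [hsplit, hdiff, eq_sub_of_add_eq hone.symm]
  ring
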